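/- arXiv:1504.05260 — 3 statements merged into one kernel-verified Lean document; each statement's English description precedes it below -/
import Mathlib

section
/- Let β, k, α, ω, S̃ be positive real numbers satisfying kβS̃ω² < α and αωk² < βS̃. Define f₄(I) = βS̃I/(1 + kI) − αI/(ω + I) for I ≥ 0. Then the second derivative f₄''(I) = −2kβS̃/(1 + kI)³ + 2αω/(ω + I)³, and there exists a unique I₁ > 0 such that f₄''(I) > 0 for all I ∈ (0, I₁), f₄''(I₁) = 0, and f₄''(I) < 0 for all I > I₁ (i.e., f₄ is convex-concave with a unique inflection point). -/
/-- For β, k, α, ω, S̃ > 0 with kβS̃ω² < α and αωk² < βS̃, the function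
f₄(I) = βS̃I/(1+kI) − αI/(ω+I) has second derivative −2kβS̃/(1+kI)³ + 2αω/(ω+I)³
on I ≥ 0, and there is a unique I₁ > 0 such that f₄'' > 0 on (0, I₁), f₄''(I₁) = 0,
and f₄'' < 0 on (I₁, ∞): f₄ is convex-concave with a unique inflection point. -/
theorem stmt_2 (β k α ω St : ℝ) (hβ : 0 < β) (hk : 0 < k) (hα : 0 < α) (hω : 0 < ω)
    (hSt : 0 < St) (h1 : k * β * St * ω ^ 2 < α) (h2 : α * ω * k ^ 2 < β * St)
    (f₄ : ℝ → ℝ) (hf : ∀ I, f₄ I = β * St * I / (1 + k * I) - α * I / (ω + I)) :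
    (∀ I : ℝ, 0 ≤ I →
      deriv (deriv f₄) I = -2 * k * β * St / (1 + k * I) ^ 3 + 2 * α * ω / (ω + I) ^ 3) ∧
    (∃ I₁ : ℝ, 0 < I₁ ∧
      (∀ I : ℝ, 0 < I → I < I₁ → 0 < deriv (deriv f₄) I) ∧
      deriv (deriv f₄) I₁ = 0 ∧
      (∀ I : ℝ, I₁ < I → deriv (deriv f₄) I < 0) ∧
      (∀ I₁' : ℝ, 0 < I₁' → deriv (deriv f₄) I₁' = 0 → I₁' = I₁)) := by
  have hd1 : ∀ x : ℝ, 0 < 1 + k * x → 0 < ω + x →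
      HasDerivAt f₄ (β * St / (1 + k * x) ^ 2 - α * ω / (ω + x) ^ 2) x := by
    intro x hx hy
    have e : f₄ = fun I => β * St * I / (1 + k * I) - α * I / (ω + I) := funext hf
    rw [e]
    have a1 : HasDerivAt (fun I : ℝ => β * St * I) (β * St * 1) x :=
      (hasDerivAt_id' x).const_mul _
    have a2 : HasDerivAt (fun I : ℝ => 1 + k * I) (k * 1) x :=
      ((hasDerivAt_id' x).const_mul k).const_add 1
    have a3 : HasDerivAt (fun I : ℝ => α * I) (α * 1) x := (hasDerivAt_id' x).const_mul _
    have a4 : HasDerivAt (fun I : ℝ => ω + I) 1 x := (hasDerivAt_id' x).const_add ω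
    refine ((a1.fun_div a2 hx.ne').fun_sub (a3.fun_div a4 hy.ne')).congr_deriv ?_
    congr 2 <;> ring
  have hd2 : ∀ I : ℝ, 0 ≤ I →
      deriv (deriv f₄) I = -2 * k * β * St / (1 + k * I) ^ 3 + 2 * α * ω / (ω + I) ^ 3 := by
    intro x h0
    have hx : 0 < 1 + k * x := by positivity
    have hy : 0 < ω + x := by positivity
    have a2 : HasDerivAt (fun I : ℝ => 1 + k * I) (k * 1) x :=
      ((hasDerivAt_id' x).const_mul k).const_add 1
    have a4 : HasDerivAt (fun I : ℝ => ω + I) 1 x := (hasDerivAt_id' x).const_add ω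
    have ev : deriv f₄ =ᶠ[nhds x]
        fun I => β * St / (1 + k * I) ^ 2 - α * ω / (ω + I) ^ 2 := by
      filter_upwards [a2.continuousAt.eventually (lt_mem_nhds hx),
        a4.continuousAt.eventually (lt_mem_nhds hy)] with y b1 b2
      exact (hd1 y b1 b2).deriv
    rw [ev.deriv_eq]
    have b := (((hasDerivAt_const x (β * St)).fun_div (a2.fun_pow 2) (by positivity)).fun_sub
      ((hasDerivAt_const x (α * ω)).fun_div (a4.fun_pow 2) (by positivity)))
    rw [b.deriv]
    field_simp
    ring
  refine ⟨hd2, ?_⟩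
  have root : ∀ a : ℝ, 0 < a → ∃ p : ℝ, 0 < p ∧ p ^ 3 = a := fun a ha =>
    ⟨a ^ ((1 : ℝ) / 3), by positivity, by
      rw [← Real.rpow_natCast, ← Real.rpow_mul ha.le]; norm_num⟩
  obtain ⟨p, hp, hp3⟩ := root (α * ω) (by positivity)
  obtain ⟨q, hq, hq3⟩ := root (k * β * St) (by positivity)
  have c1 : q * ω < p := by
    refine lt_of_pow_lt_pow_left₀ 3 hp.le ?_
    rw [mul_pow, hp3, hq3]
    nlinarith [mul_lt_mul_of_pos_right h1 hω]
  have c2 : p * k < q := by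
    refine lt_of_pow_lt_pow_left₀ 3 hq.le ?_
    rw [mul_pow, hp3, hq3]
    nlinarith [mul_lt_mul_of_pos_right h2 hk]
  have c1' := sub_pos.2 c1
  have c2' := sub_pos.2 c2
  have form : ∀ I : ℝ, 0 ≤ I →
      deriv (deriv f₄) I = 2 * ((p / (ω + I)) ^ 3 - (q / (1 + k * I)) ^ 3) := by
    intro I hI
    rw [hd2 I hI, div_pow, div_pow, hp3, hq3]
    ring
  have pos : ∀ I : ℝ, 0 < I → I < (p - q * ω) / (q - p * k) → 0 < deriv (deriv f₄) I := by
    intro I hI h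
    rw [form I hI.le]
    rw [lt_div_iff₀ c2'] at h
    have : q / (1 + k * I) < p / (ω + I) := by
      rw [div_lt_div_iff₀ (by positivity) (by positivity)]; nlinarith
    have := pow_lt_pow_left₀ this (by positivity) (n := 3) (by norm_num)
    linarith
  have neg : ∀ I : ℝ, (p - q * ω) / (q - p * k) < I → deriv (deriv f₄) I < 0 := by
    intro I h
    have hI : 0 < I := lt_trans (by positivity) h
    rw [form I hI.le]
    rw [div_lt_iff₀ c2'] at h
    have : p / (ω + I) < q / (1 + k * I) := by
      rw [div_lt_div_iff₀ (by positivity) (by positivity)]; nlinarith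
    have := pow_lt_pow_left₀ this (by positivity) (n := 3) (by norm_num)
    linarith
  have hI1 : 0 < (p - q * ω) / (q - p * k) := by positivity
  refine ⟨(p - q * ω) / (q - p * k), hI1, pos, ?_, neg, ?_⟩
  · rw [form _ hI1.le]
    have h : (p - q * ω) / (q - p * k) * (q - p * k) = p - q * ω := div_mul_cancel₀ _ c2'.ne'
    generalize (p - q * ω) / (q - p * k) = I at *
    have : p / (ω + I) = q / (1 + k * I) := by
      rw [div_eq_div_iff (by positivity) (by positivity)]; linarith
    rw [this]; ring
  · intro I hI h
    rcases lt_trichotomy I ((p - q * ω) / (q - p * k)) with g | g | g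
    · exact absurd h (pos I hI g).ne'
    · exact g
    · exact absurd h (neg I g).ne
end

section
/- Let A, B, C, D > 0 and define f₇(Y) = Y((A + B)Y + BC)/((A + B)Y² + (BC + D)Y + CD) for Y ≥ 0. Then the second derivative satisfies f₇''(Y) = −2D·g(Y)/((A + B)Y² + (BC + D)Y + CD)³, where g(Y) = (A + B)²Y³ + 3C(A + B)²Y² + 3(A + B)BC²Y + (B²C − AD)C². Moreover, if AD > B²C, then g has a unique positive root Y₁, and f₇''(Y) > 0 for Y ∈ (0, Y₁), f₇''(Y₁) = 0, and f₇''(Y) < 0 for Y > Y₁; hence f₇ is convex-concave with a unique inflection point. -/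
/-- For A, B, C, D > 0, the function
f₇(Y) = Y((A+B)Y + BC)/((A+B)Y² + (BC+D)Y + CD) has second derivative
f₇''(Y) = −2D·g(Y)/((A+B)Y² + (BC+D)Y + CD)³ with
g(Y) = (A+B)²Y³ + 3C(A+B)²Y² + 3(A+B)BC²Y + (B²C − AD)C². If AD > B²C, then g has
a unique positive root Y₁, and f₇'' > 0 on (0, Y₁), f₇''(Y₁) = 0, f₇'' < 0 on
(Y₁, ∞): f₇ is convex-concave with a unique inflection point. -/
theorem stmt_13 (A B C D : ℝ) (hA : 0 < A) (hB : 0 < B) (hC : 0 < C) (hD : 0 < D)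
    (f₇ g : ℝ → ℝ)
    (hf : ∀ Y, f₇ Y = Y * ((A + B) * Y + B * C) /
      ((A + B) * Y ^ 2 + (B * C + D) * Y + C * D))
    (hg : ∀ Y, g Y = (A + B) ^ 2 * Y ^ 3 + 3 * C * (A + B) ^ 2 * Y ^ 2 +
      3 * (A + B) * B * C ^ 2 * Y + (B ^ 2 * C - A * D) * C ^ 2) :
    (∀ Y : ℝ, 0 ≤ Y →
      deriv (deriv f₇) Y =
        -2 * D * g Y / ((A + B) * Y ^ 2 + (B * C + D) * Y + C * D) ^ 3) ∧
    (A * D > B ^ 2 * C →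
      ∃ Y₁ : ℝ, 0 < Y₁ ∧ g Y₁ = 0 ∧
        (∀ Y : ℝ, 0 < Y → g Y = 0 → Y = Y₁) ∧
        (∀ Y : ℝ, 0 < Y → Y < Y₁ → 0 < deriv (deriv f₇) Y) ∧
        deriv (deriv f₇) Y₁ = 0 ∧
        (∀ Y : ℝ, Y₁ < Y → deriv (deriv f₇) Y < 0)) := by
  have hP : ∀ Y : ℝ, 0 ≤ Y → 0 < (A + B) * Y ^ 2 + (B * C + D) * Y + C * D := by
    intro Y hY
    positivity
  have hPd : ∀ Y : ℝ, HasDerivAt (fun Y : ℝ => (A + B) * Y ^ 2 + (B * C + D) * Y + C * D)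
      (2 * (A + B) * Y + (B * C + D)) Y := by
    intro Y
    have h := ((((hasDerivAt_id' Y).pow 2).const_mul (A + B)).add
      ((hasDerivAt_id' Y).const_mul (B * C + D))).add_const (C * D)
    refine h.congr_deriv ?_
    norm_num
    ring
  have hff : f₇ = fun Y => Y * ((A + B) * Y + B * C) /
      ((A + B) * Y ^ 2 + (B * C + D) * Y + C * D) := funext hf
  have hd1 : ∀ Y : ℝ, (A + B) * Y ^ 2 + (B * C + D) * Y + C * D ≠ 0 →
      deriv f₇ Y = D * ((A + B) * Y ^ 2 + 2 * (A + B) * C * Y + B * C ^ 2) /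
        ((A + B) * Y ^ 2 + (B * C + D) * Y + C * D) ^ 2 := by
    intro Y hY
    have hn := (hasDerivAt_id' Y).mul
      (((hasDerivAt_id' Y).const_mul (A + B)).add_const (B * C))
    have h := (hn.div (hPd Y) hY).deriv
    rw [hff]
    refine Eq.trans h ?_
    congr 1
    simp only [Pi.mul_apply]
    ring
  have hd2 : ∀ Y : ℝ, 0 ≤ Y →
      deriv (deriv f₇) Y =
        -2 * D * g Y / ((A + B) * Y ^ 2 + (B * C + D) * Y + C * D) ^ 3 := by
    intro Y hY
    have hne := (hP Y hY).ne'
    have hev : deriv f₇ =ᶠ[nhds Y] fun Y =>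
        D * ((A + B) * Y ^ 2 + 2 * (A + B) * C * Y + B * C ^ 2) /
        ((A + B) * Y ^ 2 + (B * C + D) * Y + C * D) ^ 2 := by
      filter_upwards [(hPd Y).continuousAt.eventually_ne hne] with Z hZ
      exact hd1 Z hZ
    rw [hev.deriv_eq]
    have hn := (((((hasDerivAt_id' Y).pow 2).const_mul (A + B)).add
      ((hasDerivAt_id' Y).const_mul (2 * (A + B) * C))).add_const (B * C ^ 2)).const_mul D
    have h := (hn.div ((hPd Y).pow 2) (pow_ne_zero 2 hne)).deriv
    refine Eq.trans h ?_
    rw [hg]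
    simp only [Pi.pow_apply, Pi.add_apply]
    rw [div_eq_div_iff (pow_ne_zero 2 (pow_ne_zero 2 hne)) (pow_ne_zero 3 hne)]
    norm_num
    ring
  refine ⟨hd2, fun hAD => ?_⟩
  have hmono : ∀ x y : ℝ, 0 ≤ x → x < y → g x < g y := by
    intro x y hx hxy
    rw [hg, hg]
    gcongr
  have hgc : Continuous g := by
    rw [funext hg]
    fun_prop
  have h0 : g 0 < 0 := by
    rw [hg]
    have : 0 < (A * D - B ^ 2 * C) * C ^ 2 := mul_pos (by linarith) (by positivity)
    nlinarith
  have hM : 0 < g (D / B) := by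
    have e : g (D / B) = (A + B) ^ 2 * (D / B) ^ 3 + 3 * C * (A + B) ^ 2 * (D / B) ^ 2 +
        (2 * A * D + 3 * B * D + B ^ 2 * C) * C ^ 2 := by
      rw [hg]
      field_simp
      ring
    rw [e]
    positivity
  have hDB : 0 < D / B := by positivity
  obtain ⟨Y₁, hY, hgY⟩ := intermediate_value_Ioo hDB.le hgc.continuousOn ⟨h0, hM⟩
  refine ⟨Y₁, hY.1, hgY, ?_, ?_, ?_, ?_⟩
  · intro Y hY0 hg0
    rcases lt_trichotomy Y Y₁ with h | h | h
    · have := hmono _ _ hY0.le h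
      linarith
    · exact h
    · have := hmono _ _ hY.1.le h
      linarith
  · intro Y hY0 h
    rw [hd2 Y hY0.le]
    have := hmono _ _ hY0.le h
    refine div_pos ?_ (pow_pos (hP Y hY0.le) 3)
    nlinarith
  · rw [hd2 Y₁ hY.1.le, hgY]
    simp
  · intro Y h
    have hY0 : 0 < Y := hY.1.trans h
    rw [hd2 Y hY0.le]
    have := hmono _ _ hY.1.le h
    refine div_neg_of_neg_of_pos ?_ (pow_pos (hP Y hY0.le) 3)
    nlinarith
end

section
/- Consider the reduced autoimmune model dA/dt = aA − σ₁RₙA, dRₙ/dt = (bA + β)A − μₙRₙ, where a ∈ ℝ and σ₁, b, β, μₙ > 0. At any equilibrium (Ā, R̄ₙ) with Ā > 0, the Jacobian matrix of the system has trace equal to −μₙ < 0 and determinant equal to σ₁Ā(2bĀ + β) > 0; consequently, every complex root of its characteristic polynomial has negative real part (so the positive equilibrium is linearly stable for every μₙ > 0, and no Hopf bifurcation can occur from it). -/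
/-- For the reduced autoimmune model dA/dt = aA − σ₁RₙA,
dRₙ/dt = (bA + β)A − μₙRₙ (a ∈ ℝ, σ₁, b, β, μₙ > 0), at any equilibrium
(Ā, R̄ₙ) with Ā > 0 the Jacobian has trace −μₙ < 0 and determinant
σ₁Ā(2bĀ + β) > 0, so every complex root of its characteristic polynomial has
negative real part: the positive equilibrium is linearly stable for every
μₙ > 0 and no Hopf bifurcation can occur from it. -/
theorem stmt_16 (a σ₁ b β μn : ℝ) (hσ : 0 < σ₁) (hb : 0 < b) (hβ : 0 < β)
    (hμ : 0 < μn)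
    (F₁ F₂ : ℝ → ℝ → ℝ)
    (hF₁ : ∀ A Rn, F₁ A Rn = a * A - σ₁ * Rn * A)
    (hF₂ : ∀ A Rn, F₂ A Rn = (b * A + β) * A - μn * Rn)
    (Abar Rbar : ℝ) (hAbar : 0 < Abar)
    (heq₁ : F₁ Abar Rbar = 0) (heq₂ : F₂ Abar Rbar = 0)
    (J : Matrix (Fin 2) (Fin 2) ℝ)
    (hJ : J = ![![deriv (fun A => F₁ A Rbar) Abar, deriv (fun Rn => F₁ Abar Rn) Rbar],
                ![deriv (fun A => F₂ A Rbar) Abar, deriv (fun Rn => F₂ Abar Rn) Rbar]]) :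
    J.trace = -μn ∧ J.trace < 0 ∧
    J.det = σ₁ * Abar * (2 * b * Abar + β) ∧ 0 < J.det ∧
    (∀ z : ℂ, z ^ 2 - (J.trace : ℂ) * z + (J.det : ℂ) = 0 → z.re < 0) := by
  have hR : a - σ₁ * Rbar = 0 := by
    rw [hF₁] at heq₁
    have h : (a - σ₁ * Rbar) * Abar = 0 := by linarith
    exact (mul_eq_zero.mp h).resolve_right hAbar.ne'
  have d11 : deriv (fun A => F₁ A Rbar) Abar = 0 := by
    have h : HasDerivAt (fun A => F₁ A Rbar) (a * 1 - σ₁ * Rbar * 1) Abar := by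
      simp only [hF₁]
      exact ((hasDerivAt_id' Abar).const_mul a).sub ((hasDerivAt_id' Abar).const_mul (σ₁ * Rbar))
    rw [h.deriv]; linarith
  have d12 : deriv (fun Rn => F₁ Abar Rn) Rbar = -(σ₁ * Abar) := by
    have h : HasDerivAt (fun Rn => F₁ Abar Rn) (0 - σ₁ * 1 * Abar) Rbar := by
      simp only [hF₁]
      exact (hasDerivAt_const Rbar (a * Abar)).sub
        (((hasDerivAt_id' Rbar).const_mul σ₁).mul_const Abar)
    rw [h.deriv]; ring
  have d21 : deriv (fun A => F₂ A Rbar) Abar = 2 * b * Abar + β := by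
    have h : HasDerivAt (fun A => F₂ A Rbar)
        ((b * 1) * Abar + (b * Abar + β) * 1) Abar := by
      simp only [hF₂]
      exact ((((hasDerivAt_id' Abar).const_mul b).add_const β).mul
        (hasDerivAt_id' Abar)).sub_const (μn * Rbar)
    rw [h.deriv]; ring
  have d22 : deriv (fun Rn => F₂ Abar Rn) Rbar = -μn := by
    have h : HasDerivAt (fun Rn => F₂ Abar Rn) (0 - μn * 1) Rbar := by
      simp only [hF₂]
      exact (hasDerivAt_const Rbar ((b * Abar + β) * Abar)).sub
        ((hasDerivAt_id' Rbar).const_mul μn)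
    rw [h.deriv]; ring
  rw [d11, d12, d21, d22] at hJ
  have j11 : J 0 0 = 0 := by subst hJ; rfl
  have j12 : J 0 1 = -(σ₁ * Abar) := by subst hJ; rfl
  have j21 : J 1 0 = 2 * b * Abar + β := by subst hJ; rfl
  have j22 : J 1 1 = -μn := by subst hJ; rfl
  have ht : J.trace = -μn := by
    rw [Matrix.trace_fin_two, j11, j22]; ring
  have hd : J.det = σ₁ * Abar * (2 * b * Abar + β) := by
    rw [Matrix.det_fin_two, j11, j12, j21, j22]; ring
  have hpos : 0 < J.det := by rw [hd]; positivity
  refine ⟨ht, by linarith, hd, hpos, ?_⟩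
  intro z hz
  rw [ht] at hz
  generalize J.det = D at hz hpos
  have hre := congrArg Complex.re hz
  have him := congrArg Complex.im hz
  simp [pow_two] at hre him
  by_contra hx
  push Not at hx
  have hy : z.im * (2 * z.re + μn) = 0 := by linarith
  have hy0 : z.im = 0 := (mul_eq_zero.mp hy).resolve_right (by positivity)
  rw [hy0] at hre
  nlinarith [mul_nonneg hμ.le hx, mul_nonneg hx hx]
end
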